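/- arXiv:0806.0424 — 2 statements merged into one kernel-verified Lean document; each statement's English description precedes it below -/
import Mathlib

section
/- For every integer n ≥ 1, p_{n;=n}^n = p_{n−1}; for all integers k ≥ 1 and n ≥ k+1, p_{n;=n−k}^{n−k} = p_{n−1;≤n−k}; and for all integers k ≥ 1, n ≥ k+2, and 1 ≤ l ≤ n−k−1, p_{n;=n−k}^l = p_{n;=n−k+1}^l + C(n−1,k+1) · p_{n−k−1}^l − Σ_{i=1}^{k} C(n−1,i) · p_{n−i;=n−k}^l. -/
/-- A parking function of length `n`: a sequence of positive integers whose
nondecreasing rearrangement `b` satisfies `b i ≤ i` (1-indexed). -/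
def IsParkingFunction (n : ℕ) (a : Fin n → ℕ) : Prop :=
  (∀ i, 1 ≤ a i) ∧
  ∃ σ : Equiv.Perm (Fin n), Monotone (a ∘ σ) ∧ ∀ i : Fin n, a (σ i) ≤ (i : ℕ) + 1

/-- A parking function of length `n` with `m ≥ n` parking spaces: entries in `[1,m]`
whose nondecreasing rearrangement `b` satisfies `b i ≤ m - n + i` (1-indexed). -/
def IsParkingFunctionWith (n m : ℕ) (a : Fin n → ℕ) : Prop :=
  (∀ i, 1 ≤ a i ∧ a i ≤ m) ∧
  ∃ σ : Equiv.Perm (Fin n), Monotone (a ∘ σ) ∧ ∀ i : Fin n, a (σ i) ≤ m - n + ((i : ℕ) + 1)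

/-- `pN n` = number of parking functions of length `n` (so `pN n = (n+1)^(n-1)`). -/
noncomputable def pN (n : ℕ) : ℕ := Nat.card {a : Fin n → ℕ // IsParkingFunction n a}

/-- `pWith n m` = `p_{n,m;≤m}`, the number of parking functions of length `n`
with `m` parking spaces. -/
noncomputable def pWith (n m : ℕ) : ℕ := Nat.card {a : Fin n → ℕ // IsParkingFunctionWith n m a}

/-- `pLe n s` = `p_{n;≤s}`, the number of parking functions of length `n`
all of whose entries are at most `s`. -/
noncomputable def pLe (n s : ℕ) : ℕ :=
  Nat.card {a : Fin n → ℕ // IsParkingFunction n a ∧ ∀ i, a i ≤ s}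

/-- `pEq n s` = `p_{n;=s} = p_{n;≤s} - p_{n;≤s-1}` (with `p_{n;≤s} = 0` for `s < 0`). -/
noncomputable def pEq (n s : ℕ) : ℕ := pLe n s - (if s = 0 then 0 else pLe n (s - 1))

/-- `pLeL n s l` = `p_{n;≤s}^l`, the number of parking functions of length `n` with all
entries at most `s` and first entry equal to `l`. -/
noncomputable def pLeL (n s l : ℕ) : ℕ :=
  Nat.card {a : Fin n → ℕ //
    IsParkingFunction n a ∧ (∀ i, a i ≤ s) ∧ (List.ofFn a).head? = some l}

/-- `pL n l` = `p_n^l`, the number of parking functions of length `n` with first entry `l`. -/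
noncomputable def pL (n l : ℕ) : ℕ :=
  Nat.card {a : Fin n → ℕ //
    IsParkingFunction n a ∧ (List.ofFn a).head? = some l}

/-- `pEqL n s l` = `p_{n;=s}^l = p_{n;≤s}^l - p_{n;≤s-1}^l`. -/
noncomputable def pEqL (n s l : ℕ) : ℕ := pLeL n s l - (if s = 0 then 0 else pLeL n (s - 1) l)

/-- Simulate the parking process with `m` spaces: cars arrive in order with the given
preference list, each parks in the first free space among `pref, pref+1, …, m` if any;
returns the number of cars that leave unparked, given the set `occ` of occupied spaces. -/
def flawCount (m : ℕ) : List ℕ → Finset ℕ → ℕ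
  | [], _ => 0
  | p :: rest, occ =>
    match (List.range' p (m + 1 - p)).find? (fun s => decide (s ∉ occ)) with
    | some s => flawCount m rest (insert s occ)
    | none => flawCount m rest occ + 1

/-- `pFlaw n m k` = `p_{n,m;≤m;k}`, the number of `k`-flaw preference sets of length `n`
with `m` parking spaces and all entries in `[1,m]`. -/
noncomputable def pFlaw (n m k : ℕ) : ℕ :=
  Nat.card {a : Fin n → ℕ //
    (∀ i, 1 ≤ a i ∧ a i ≤ m) ∧ flawCount m (List.ofFn a) ∅ = k}

/-- `P(x) = Σ_{n≥0} (n+1)^(n-1) xⁿ/n!` in `ℚ[[x]]`. -/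
noncomputable def Pser : PowerSeries ℚ :=
  PowerSeries.mk fun n => ((n : ℚ) + 1) ^ (n - 1) / n.factorial

/-- `Q_k(x) = Σ_{n≥0} p_{n,n+k;≤n+k} xⁿ/n!` in `ℚ[[x]]`. -/
noncomputable def Qser (k : ℕ) : PowerSeries ℚ :=
  PowerSeries.mk fun n => (pWith n (n + k) : ℚ) / n.factorial

/-- `R_k(x) = Σ_{n≥k} p_{n;≤n-k} xⁿ/n!` in `ℚ[[x]]`. -/
noncomputable def Rser (k : ℕ) : PowerSeries ℚ :=
  PowerSeries.mk fun n => if n < k then 0 else (pLe n (n - k) : ℚ) / n.factorial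

/-- `H_k(x) = Σ_{n≥k} p_{n;=n-k} xⁿ/n!` in `ℚ[[x]]`. -/
noncomputable def Hser (k : ℕ) : PowerSeries ℚ :=
  PowerSeries.mk fun n => if n < k then 0 else (pEq n (n - k) : ℚ) / n.factorial

/-- `T_k(x) = Σ_{n≥k+1} p_n^{n-k} xⁿ/(n-1)!` in `ℚ[[x]]`. -/
noncomputable def Tser (k : ℕ) : PowerSeries ℚ :=
  PowerSeries.mk fun n => if n < k + 1 then 0 else (pL n (n - k) : ℚ) / (n - 1).factorial

/-- `F_{k,s}(x) = Σ_{n≥s+1} p_{n;≤n-k}^{n-s} xⁿ/(n-1)!` in `ℚ[[x]]`. -/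
noncomputable def Fser (k s : ℕ) : PowerSeries ℚ :=
  PowerSeries.mk fun n =>
    if n < s + 1 then 0 else (pLeL n (n - k) (n - s) : ℚ) / (n - 1).factorial
open Finset in
/-- counting characterization of parking functions -/
lemma isPF_iff (n : ℕ) (a : Fin n → ℕ) :
    IsParkingFunction n a ↔
      (∀ i, 1 ≤ a i) ∧ ∀ j ≤ n, j ≤ (univ.filter fun i => a i ≤ j).card := by
  unfold IsParkingFunction
  refine and_congr_right fun _ => ⟨?_, ?_⟩
  · rintro ⟨σ, -, h⟩ j hj
    have h1 : ((univ : Finset (Fin j)).map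
        ((Fin.castLEEmb hj).trans σ.toEmbedding)) ⊆ univ.filter fun i => a i ≤ j := by
      intro x hx
      simp only [mem_map, mem_univ, true_and] at hx
      obtain ⟨y, rfl⟩ := hx
      simp only [mem_filter, mem_univ, true_and]
      have h2 := h (Fin.castLE hj y)
      have h3 := y.2
      simp at h2 ⊢
      omega
    simpa using card_le_card h1
  · intro h
    refine ⟨Tuple.sort a, Tuple.monotone_sort a, fun i => ?_⟩
    by_contra hlt
    push Not at hlt
    have h1 := h (i + 1) i.2
    have h2 : (univ.filter fun k => a k ≤ i + 1) ⊆
        (Finset.Iio i).map (Tuple.sort a).toEmbedding := by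
      intro x hx
      simp only [mem_filter, mem_univ, true_and] at hx
      simp only [mem_map]
      refine ⟨(Tuple.sort a).symm x, ?_, by simp⟩
      rw [mem_Iio]
      by_contra hle
      push Not at hle
      have := Tuple.monotone_sort a hle
      simp at this
      omega
    have h3 := card_le_card h2
    simp at h3
    omega

/-- the condition on the tail of a parking function with first entry `l` -/
def TailOK (ι : Type) [Fintype ι] (t l : ℕ) (b : ι → ℕ) : Prop :=
  (∀ i, 1 ≤ b i ∧ b i ≤ t) ∧
    ∀ j ≤ t, j ≤ (Finset.univ.filter fun i => b i ≤ j).card + if l ≤ j then 1 else 0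

noncomputable def tailCount (ι : Type) [Fintype ι] (t l : ℕ) : ℕ :=
  Nat.card {b : ι → ℕ // TailOK ι t l b}

lemma tail_finite (ι : Type) [Fintype ι] (t l : ℕ) : Finite {b : ι → ℕ // TailOK ι t l b} := by
  have : Set.Finite {b : ι → ℕ | ∀ i, b i ∈ Set.Iic t} :=
    Set.Finite.pi' fun _ => Set.finite_Iic t
  exact (this.subset (show {b | TailOK ι t l b} ⊆ _ from fun b hb i => (hb.1 i).2)).to_subtype

lemma tailCount_congr {ι κ : Type} [Fintype ι] [Fintype κ] (e : ι ≃ κ) (t l : ℕ) :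
    tailCount ι t l = tailCount κ t l := by
  unfold tailCount
  refine Nat.card_congr (Equiv.subtypeEquiv (Equiv.arrowCongr e (Equiv.refl ℕ)) fun b => ?_)
  unfold TailOK
  refine and_congr ?_ ?_
  · simp [e.symm.forall_congr_left]
  · refine forall₂_congr fun j _ => ?_
    have : (Finset.univ.filter fun i => b i ≤ j).card =
        (Finset.univ.filter fun i => (Equiv.arrowCongr e (Equiv.refl ℕ)) b i ≤ j).card := by
      refine Finset.card_equiv e fun i => ?_
      simp
    rw [this]

lemma tailCount_eq_zero (ι : Type) [Fintype ι] (t l : ℕ) (h : Fintype.card ι + 1 < t) :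
    tailCount ι t l = 0 := by
  unfold tailCount
  have : IsEmpty {b : ι → ℕ // TailOK ι t l b} := by
    refine ⟨fun ⟨b, hb⟩ => ?_⟩
    have h1 := hb.2 t le_rfl
    have h2 := Finset.card_le_univ (Finset.univ.filter fun i => b i ≤ t)
    split_ifs at h1 <;> omega
  simp

lemma pLeL_eq (m s l : ℕ) (hs : s ≤ m + 1) (hl : 1 ≤ l) (hls : l ≤ s) :
    pLeL (m + 1) s l = tailCount (Fin m) s l := by
  unfold pLeL tailCount
  symm
  refine Nat.card_congr
    { toFun := fun b => ⟨Fin.cons l b.1, ?_⟩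
      invFun := fun a => ⟨Fin.tail a.1, ?_⟩
      left_inv := fun b => by simp
      right_inv := ?_ }
  · obtain ⟨b, hb⟩ := b
    rw [isPF_iff]
    refine ⟨⟨?_, ?_⟩, ?_, ?_⟩
    · intro i
      refine Fin.cases ?_ (fun i => ?_) i
      · simpa using hl
      · simpa using (hb.1 i).1
    · intro j hj
      rw [Fin.card_filter_univ_succ]
      simp only [Fin.cons_zero, Fin.cons_succ]
      rcases le_or_gt j s with hjs | hjs
      · have := hb.2 j hjs
        split_ifs at this ⊢ <;> omega
      · have : (Finset.univ.filter fun i => b i ≤ j) = Finset.univ := by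
          refine Finset.filter_true_of_mem fun i _ => ?_
          have := (hb.1 i).2
          omega
        rw [this, if_pos (by omega)]
        simpa using hj
    · intro i
      refine Fin.cases ?_ (fun i => ?_) i
      · simpa using hls
      · simpa using (hb.1 i).2
    · simp
  · obtain ⟨a, ha, has, hal⟩ := a
    rw [isPF_iff] at ha
    have hal' : a 0 = l := by simpa using hal
    refine ⟨fun i => ⟨ha.1 _, has _⟩, fun j hj => ?_⟩
    have := ha.2 j (by omega)
    rw [Fin.card_filter_univ_succ] at this
    simp only [hal'] at this
    change j ≤ (Finset.univ.filter fun i : Fin m => a i.succ ≤ j).card + _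
    split_ifs at this ⊢ <;> omega
  · rintro ⟨a, ha, has, hal⟩
    have hal' : a 0 = l := by simpa using hal
    subst hal'
    simp

lemma tail_step (ι : Type) [Fintype ι] [DecidableEq ι] (s l : ℕ) (hl : l ≤ s)
    (hs : s + 1 ≤ Fintype.card ι + 1) :
    tailCount ι (s + 1) l = ∑ S : Finset ι, tailCount S s l := by
  classical
  have := tail_finite ι (s + 1) l
  let f : {b : ι → ℕ // TailOK ι (s + 1) l b} → Finset ι :=
    fun b => Finset.univ.filter fun i => b.1 i ≤ s
  have h1 : tailCount ι (s + 1) l = ∑ S : Finset ι, Nat.card {b // f b = S} := by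
    unfold tailCount
    rw [← Nat.card_congr (Equiv.sigmaFiberEquiv f), Nat.card_sigma]
  rw [h1]
  refine Finset.sum_congr rfl fun S _ => ?_
  unfold tailCount
  have key : ∀ (b : ι → ℕ), (∀ i, i ∈ S ↔ b i ≤ s) → ∀ j ≤ s,
      (Finset.univ.filter fun i => b i ≤ j).card =
      (Finset.univ.filter fun i : S => b i ≤ j).card := by
    intro b hb j hj
    rw [← Finset.card_map (Function.Embedding.subtype (· ∈ S))]
    congr 1
    ext i
    simp only [Finset.mem_filter, Finset.mem_univ, true_and, Finset.mem_map,
      Function.Embedding.subtype_apply, Subtype.exists, exists_and_left, exists_prop]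
    constructor
    · intro h
      exact ⟨i, h, (hb i).2 (by omega), rfl⟩
    · rintro ⟨x, h, _, rfl⟩
      exact h
  refine Nat.card_congr
    { toFun := fun b => ⟨fun i => b.1.1 i, ?_⟩
      invFun := fun c => ⟨⟨fun i => if h : i ∈ S then c.1 ⟨i, h⟩ else s + 1, ?_⟩, ?_⟩
      left_inv := ?_
      right_inv := ?_ }
  · obtain ⟨⟨b, hb⟩, hf⟩ := b
    have hS : ∀ i, i ∈ S ↔ b i ≤ s := by
      intro i
      rw [← hf]
      simp [f]
    refine ⟨fun i => ⟨(hb.1 i).1, (hS i).1 i.2⟩, fun j hj => ?_⟩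
    have := hb.2 j (by omega)
    rwa [key b hS j hj] at this
  · obtain ⟨c, hc⟩ := c
    set b : ι → ℕ := fun i => if h : i ∈ S then c ⟨i, h⟩ else s + 1 with hbdef
    have hS : ∀ i, i ∈ S ↔ b i ≤ s := by
      intro i
      by_cases h : i ∈ S
      · simp [hbdef, h, (hc.1 ⟨i, h⟩).2]
      · simp [hbdef, h]
    have hb1 : ∀ i, 1 ≤ b i ∧ b i ≤ s + 1 := by
      intro i
      by_cases h : i ∈ S
      · have := hc.1 ⟨i, h⟩
        simp only [hbdef, h, dite_true]
        omega
      · simp [hbdef, h]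
    refine ⟨hb1, fun j hj => ?_⟩
    rcases Nat.lt_or_ge s j with hjs | hjs
    · have : (Finset.univ.filter fun i => b i ≤ j) = Finset.univ := by
        refine Finset.filter_true_of_mem fun i _ => ?_
        have := (hb1 i).2
        omega
      change j ≤ (Finset.univ.filter fun i => b i ≤ j).card + _
      rw [this, if_pos (by omega), Finset.card_univ]
      omega
    · have := hc.2 j hjs
      change j ≤ (Finset.univ.filter fun i => b i ≤ j).card + _
      rw [key b hS j hjs]
      simpa [hbdef] using this
  · obtain ⟨c, hc⟩ := c
    ext i
    by_cases h : i ∈ S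
    · simp [f, h, (hc.1 ⟨i, h⟩).2]
    · simp [f, h]
  · rintro ⟨⟨b, hb⟩, hf⟩
    have hS : ∀ i, i ∈ S ↔ b i ≤ s := by
      intro i
      rw [← hf]
      simp [f]
    refine Subtype.ext (Subtype.ext (funext fun i => ?_))
    by_cases h : i ∈ S
    · simp [h]
    · have h2 := (hS i).not.1 h
      have h3 := (hb.1 i).2
      simp only [h, dite_false]
      omega
  · rintro ⟨c, hc⟩
    refine Subtype.ext (funext fun i => ?_)
    simp

lemma key_rec (m s l : ℕ) (hs : s ≤ m) (hl : 1 ≤ l) (hls : l ≤ s) :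
    pLeL (m + 1) (s + 1) l = ∑ j ∈ Finset.range (m - s + 2),
      m.choose j * pLeL (m + 1 - j) s l := by
  rw [pLeL_eq m (s + 1) l (by omega) hl (by omega), tail_step _ s l hls (by simpa using hs)]
  have h1 : ∀ S : Finset (Fin m), tailCount S s l = tailCount (Fin S.card) s l :=
    fun S => tailCount_congr S.equivFin s l
  simp only [h1]
  rw [← Finset.powerset_univ, Finset.sum_powerset_apply_card (fun c => tailCount (Fin c) s l)]
  simp only [Finset.card_univ, Fintype.card_fin, smul_eq_mul]
  rw [← Finset.sum_range_reflect]
  have h2 : Finset.range (m - s + 2) ⊆ Finset.range (m + 1) := by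
    intro x
    simp only [Finset.mem_range]
    omega
  symm
  refine (Finset.sum_subset_zero_on_sdiff h2 ?_ ?_)
  · intro j hj
    simp only [Finset.mem_sdiff, Finset.mem_range] at hj
    rw [tailCount_eq_zero _ _ _ (by simp; omega), mul_zero]
  · intro j hj
    simp only [Finset.mem_range] at hj
    rw [show m + 1 - 1 - j = m - j by omega, Nat.choose_symm (by omega : j ≤ m),
      show m + 1 - j = (m - j) + 1 by omega, pLeL_eq _ _ _ (by omega) hl hls]

lemma key_rec' (m s l : ℕ) (hs : s ≤ m) (hl : 1 ≤ l) (hls : l ≤ s) :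
    pLeL (m + 1) (s + 1) l = pLeL (m + 1) s l + ∑ j ∈ Finset.Icc 1 (m - s + 1),
      m.choose j * pLeL (m + 1 - j) s l := by
  rw [key_rec m s l hs hl hls, Finset.range_eq_Ico, Finset.sum_eq_sum_Ico_succ_bot (by omega)]
  simp
  rfl

lemma pEqL_self (m s : ℕ) (hs1 : 1 ≤ s) (hs : s ≤ m + 1) :
    pEqL (m + 1) s s = pLe m s := by
  have h0 : pLeL (m + 1) (s - 1) s = 0 := by
    unfold pLeL
    have : IsEmpty {a : Fin (m + 1) → ℕ //
        IsParkingFunction (m + 1) a ∧ (∀ i, a i ≤ s - 1) ∧ (List.ofFn a).head? = some s} := by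
      refine ⟨fun ⟨a, _, h1, h2⟩ => ?_⟩
      have h3 : a 0 = s := by simpa using h2
      have := h1 0
      omega
    exact Nat.card_of_isEmpty
  unfold pEqL
  rw [if_neg (by omega), h0, Nat.sub_zero, pLeL_eq m s s hs hs1 le_rfl]
  unfold tailCount pLe
  refine Nat.card_congr (Equiv.subtypeEquivRight fun b => ?_)
  rw [isPF_iff]
  unfold TailOK
  have hfull : (∀ i, b i ≤ s) → ∀ j, s ≤ j →
      (Finset.univ.filter fun i => b i ≤ j).card = m := by
    intro h j hj
    rw [Finset.filter_true_of_mem fun i _ => (h i).trans hj]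
    simp
  constructor
  · rintro ⟨h1, h2⟩
    refine ⟨⟨fun i => (h1 i).1, fun j hj => ?_⟩, fun i => (h1 i).2⟩
    rcases Nat.lt_or_ge j s with h | h
    · have := h2 j h.le
      rw [if_neg (by omega)] at this
      simpa using this
    · rw [hfull (fun i => (h1 i).2) j h]
      exact hj
  · rintro ⟨⟨h1, h2⟩, h3⟩
    refine ⟨fun i => ⟨h1 i, h3 i⟩, fun j hj => ?_⟩
    rcases Nat.lt_or_ge j s with h | h
    · exact (h2 j (by omega)).trans (Nat.le_add_right _ _)
    · rw [hfull h3 j h, if_pos h]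
      omega

lemma isPF_le {n : ℕ} {a : Fin n → ℕ} (h : IsParkingFunction n a) (i : Fin n) : a i ≤ n := by
  obtain ⟨_, σ, _, h⟩ := h
  have h1 := h (σ.symm i)
  have h2 := (σ.symm i).2
  simp at h1
  omega

lemma pLe_full (m s : ℕ) (h : m ≤ s) : pLe m s = pN m := by
  unfold pLe pN
  refine Nat.card_congr (Equiv.subtypeEquivRight fun b => ?_)
  exact and_iff_left_of_imp fun hb i => (isPF_le hb i).trans h

lemma pLeL_full (m l : ℕ) : pLeL m m l = pL m l := by
  unfold pLeL pL
  refine Nat.card_congr (Equiv.subtypeEquivRight fun b => ?_)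
  exact and_congr_right fun hb => and_iff_right (isPF_le hb)

/-- `p_{n;=n}^n = p_{n-1}`; `p_{n;=n-k}^{n-k} = p_{n-1;≤n-k}`; and for
`k ≥ 1`, `n ≥ k+2`, `1 ≤ l ≤ n-k-1`:
`p_{n;=n-k}^l = p_{n;=n-k+1}^l + C(n-1,k+1) p_{n-k-1}^l - Σ_{i=1}^k C(n-1,i) p_{n-i;=n-k}^l`. -/
theorem stmt12 :
    (∀ n : ℕ, 1 ≤ n → pEqL n n n = pN (n - 1)) ∧
    (∀ k n : ℕ, 1 ≤ k → k + 1 ≤ n → pEqL n (n - k) (n - k) = pLe (n - 1) (n - k)) ∧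
    (∀ k n l : ℕ, 1 ≤ k → k + 2 ≤ n → 1 ≤ l → l ≤ n - k - 1 →
      (pEqL n (n - k) l : ℤ) =
        (pEqL n (n - k + 1) l : ℤ) +
          ((n - 1).choose (k + 1) : ℤ) * (pL (n - k - 1) l : ℤ) -
          ∑ i ∈ Finset.Icc 1 k, ((n - 1).choose i : ℤ) * (pEqL (n - i) (n - k) l : ℤ)) := by
  refine ⟨?_, ?_, ?_⟩
  · intro n hn
    obtain ⟨m, rfl⟩ := Nat.exists_eq_add_of_le' hn
    rw [pEqL_self m (m + 1) (by omega) le_rfl]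
    exact pLe_full m (m + 1) (by omega)
  · intro k n hk hn
    obtain ⟨m, rfl⟩ := Nat.exists_eq_add_of_le' (show 1 ≤ n by omega)
    exact pEqL_self m _ (by omega) (by omega)
  · intro k n l hk hn hl hlk
    obtain ⟨t, rfl⟩ : ∃ t, n = t + k + 1 := ⟨n - k - 1, by omega⟩
    rw [show t + k + 1 - k = t + 1 by omega] at *
    rw [Nat.add_sub_cancel, Nat.add_sub_cancel]
    rw [Nat.add_sub_cancel] at hlk
    have e1 : pEqL (t + k + 1) (t + 1) l = ∑ j ∈ Finset.Icc 1 (k + 1),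
        (t + k).choose j * pLeL (t + k + 1 - j) t l := by
      have := key_rec' (t + k) t l (by omega) hl hlk
      rw [show t + k - t = k by omega] at this
      simp only [pEqL, Nat.add_sub_cancel, Nat.succ_ne_zero, if_false]
      omega
    have e2 : pEqL (t + k + 1) (t + 1 + 1) l = ∑ j ∈ Finset.Icc 1 k,
        (t + k).choose j * pLeL (t + k + 1 - j) (t + 1) l := by
      have := key_rec' (t + k) (t + 1) l (by omega) hl (by omega)
      rw [show t + k - (t + 1) + 1 = k by omega] at this
      simp only [pEqL, Nat.add_sub_cancel, Nat.succ_ne_zero, if_false]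
      omega
    have e3 : ∀ i ∈ Finset.Icc 1 k, ((t + k).choose i : ℤ) * (pEqL (t + k + 1 - i) (t + 1) l : ℤ)
        = ((t + k).choose i : ℤ) * (pLeL (t + k + 1 - i) (t + 1) l : ℤ)
          - ((t + k).choose i : ℤ) * (pLeL (t + k + 1 - i) t l : ℤ) := by
      intro i hi
      rw [Finset.mem_Icc] at hi
      have := key_rec' (t + k - i) t l (by omega) hl hlk
      rw [show t + k - i + 1 = t + k + 1 - i by omega] at this
      simp only [pEqL, Nat.add_sub_cancel, Nat.succ_ne_zero, if_false]
      rw [Nat.cast_sub (by omega), mul_sub]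
    rw [Finset.sum_congr rfl e3, Finset.sum_sub_distrib, e1, e2,
      Finset.sum_Icc_succ_top (by omega), show t + k + 1 - (k + 1) = t by omega, pLeL_full]
    push_cast
    ring
end

section
/- For every integer n ≥ 1: (i) the number p_n^n of parking functions of length n with first entry equal to n equals p_{n−1}, the number of parking functions of length n−1; and (ii) the number p_n^1 of parking functions of length n with first entry equal to 1 equals p_{n−1,n;≤n}, the number of parking functions of length n−1 with n parking spaces. -/
lemma park_count (n c : ℕ) (a : Fin n → ℕ) :
    (∃ σ : Equiv.Perm (Fin n), Monotone (a ∘ σ) ∧ ∀ i : Fin n, a (σ i) ≤ c + ((i : ℕ) + 1)) ↔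
      ∀ k, k ≤ n → k ≤ (Finset.univ.filter fun i => a i ≤ c + k).card := by
  constructor
  · rintro ⟨σ, -, h⟩ k hk
    have := Finset.card_le_card_of_injOn (s := (Finset.univ : Finset (Fin k)))
      (t := Finset.univ.filter fun i => a i ≤ c + k) (fun i => σ (Fin.castLE hk i))
      (by
        intro i _
        have h1 := h (Fin.castLE hk i)
        have h2 := i.2
        simp only [Fin.val_castLE] at h1
        simp only [Finset.coe_filter, Finset.mem_univ, true_and, Set.mem_ofPred_eq]
        omega)
      (by
        intro i _ j _ hij
        exact Fin.castLE_injective hk (σ.injective hij))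
    simpa using this
  · intro h
    refine ⟨Tuple.sort a, Tuple.monotone_sort a, fun i => ?_⟩
    by_contra hc
    have h1 := h (i + 1) i.2
    have h2 : (Finset.univ.filter fun j => a j ≤ c + ((i : ℕ) + 1)) ⊆
        (Finset.Iio i).map (Tuple.sort a).toEmbedding := by
      intro j hj
      simp only [Finset.mem_filter, Finset.mem_univ, true_and] at hj
      simp only [Finset.mem_map_equiv, Finset.mem_Iio]
      by_contra hlt
      have := Tuple.monotone_sort a (not_lt.mp hlt)
      simp at this
      omega
    have h3 := Finset.card_le_card h2
    simp at h3
    omega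

lemma cons_count (m x t : ℕ) (b : Fin m → ℕ) :
    (Finset.univ.filter fun i => (Fin.cons x b : Fin (m + 1) → ℕ) i ≤ t).card =
      (if x ≤ t then 1 else 0) + (Finset.univ.filter fun i => b i ≤ t).card := by
  simp only [Finset.card_filter, Fin.sum_univ_succ, Fin.cons_zero, Fin.cons_succ]

lemma pf_iff (n : ℕ) (a : Fin n → ℕ) : IsParkingFunction n a ↔
    (∀ i, 1 ≤ a i) ∧ ∀ k, k ≤ n → k ≤ (Finset.univ.filter fun i => a i ≤ k).card := by
  have := park_count n 0 a
  simp only [zero_add] at this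
  rw [IsParkingFunction, this]

lemma pL_cons (m x : ℕ) : pL (m + 1) x =
    Nat.card {b : Fin m → ℕ // IsParkingFunction (m + 1) (Fin.cons x b : Fin (m + 1) → ℕ)} := by
  have key : ∀ a : Fin (m + 1) → ℕ, (List.ofFn a).head? = some x →
      (Fin.cons x (Fin.tail a) : Fin (m + 1) → ℕ) = a := by
    intro a ha
    have : a 0 = x := by simpa [List.ofFn_succ] using ha
    rw [← this, Fin.cons_self_tail]
  refine Nat.card_congr ⟨fun a => ⟨Fin.tail a.1, ?_⟩, fun b => ⟨Fin.cons x b.1, b.2, ?_⟩, ?_, ?_⟩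
  · rw [key a.1 a.2.2]; exact a.2.1
  · simp [List.ofFn_succ]
  · intro a
    exact Subtype.ext (key a.1 a.2.2)
  · intro b
    exact Subtype.ext (by simp)

/-- `p_n^n = p_{n-1}` and `p_n^1 = p_{n-1,n;≤n}` for `n ≥ 1`. -/
theorem stmt16 (n : ℕ) (hn : 1 ≤ n) :
    pL n n = pN (n - 1) ∧ pL n 1 = pWith (n - 1) n := by
  obtain ⟨m, rfl⟩ : ∃ m, n = m + 1 := ⟨n - 1, by omega⟩
  simp only [Nat.add_sub_cancel]
  have mono : ∀ (b : Fin m → ℕ) (s t : ℕ), s ≤ t →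
      (Finset.univ.filter fun i => b i ≤ s).card ≤ (Finset.univ.filter fun i => b i ≤ t).card := by
    intro b s t hst
    apply Finset.card_le_card
    intro i hi
    simp only [Finset.mem_filter, Finset.mem_univ, true_and] at hi ⊢
    omega
  constructor
  · rw [pL_cons, pN]
    refine Nat.card_congr (Equiv.subtypeEquivRight fun b => ?_)
    rw [pf_iff, pf_iff]
    simp only [cons_count, Fin.forall_fin_succ, Fin.cons_zero, Fin.cons_succ]
    constructor
    · rintro ⟨⟨-, h1⟩, h2⟩
      refine ⟨h1, fun k hk => ?_⟩
      have := h2 k (by omega)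
      rw [if_neg (by omega)] at this
      omega
    · rintro ⟨h1, h2⟩
      refine ⟨⟨by omega, h1⟩, fun k hk => ?_⟩
      rcases Nat.lt_or_ge m k with h | h
      · rw [if_pos (by omega)]
        have := h2 m le_rfl
        have := mono b m k (by omega)
        omega
      · have := h2 k h
        omega
  · rw [pL_cons, pWith]
    refine Nat.card_congr (Equiv.subtypeEquivRight fun b => ?_)
    rw [pf_iff, IsParkingFunctionWith, show m + 1 - m = 1 by omega, park_count]
    simp only [cons_count, Fin.forall_fin_succ, Fin.cons_zero, Fin.cons_succ]
    constructor
    · rintro ⟨⟨-, h1⟩, h2⟩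
      have h3 : ∀ k, k ≤ m → k ≤ (Finset.univ.filter fun i => b i ≤ 1 + k).card := by
        intro k hk
        have := h2 (1 + k) (by omega)
        rw [if_pos (by omega)] at this
        omega
      refine ⟨fun i => ⟨h1 i, ?_⟩, h3⟩
      have h4 : (Finset.univ.filter fun i => b i ≤ 1 + m) = Finset.univ := by
        apply Finset.eq_univ_of_card
        apply le_antisymm (Finset.card_le_univ _)
        simpa using h3 m le_rfl
      have := Finset.mem_univ i
      rw [← h4] at this
      simp only [Finset.mem_filter, Finset.mem_univ, true_and] at this
      omega
    · rintro ⟨h1, h2⟩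
      refine ⟨⟨le_rfl, fun i => (h1 i).1⟩, fun k hk => ?_⟩
      rcases k with _ | k
      · omega
      · have := h2 k (by omega)
        rw [if_pos (by omega), Nat.add_comm k 1]
        omega
end
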